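/- arXiv:1801.05259 — 2 statements merged into one kernel-verified Lean document; each statement's English description precedes it below -/
import Mathlib

section
/- The free Schrödinger flow satisfies the scale-differentiability (sc¹) Fréchet condition at the zeroth level: for every t ∈ ℝ and u ∈ l^{2,2}, one has lim ‖φ(t+h, u+ξ) − φ(t,u) − φ(t,ξ) − h·(−i n² e^{-i t n²} u_n)_n‖_0 / (|h| + ‖ξ‖_2) = 0, where the limit is taken as (h,ξ) → (0,0) with h ∈ ℝ, ξ ∈ l^{2,2}, and |h| + ‖ξ‖_2 > 0. -/
open Filter Topology

noncomputable section

/-- Membership in the weighted space `l^{2,s}_ν`: `Σ_n |x_n|² ν_n^{2s} < ∞`. -/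
def WMem {𝕜 : Type*} [RCLike 𝕜] (ν : ℤ → ℝ) (s : ℤ) (x : ℤ → 𝕜) : Prop :=
  Summable fun n => ‖x n‖ ^ 2 * ν n ^ (2 * s)

/-- The norm `‖x‖_s = (Σ_n |x_n|² ν_n^{2s})^{1/2}` on `l^{2,s}_ν`. -/
def wnorm {𝕜 : Type*} [RCLike 𝕜] (ν : ℤ → ℝ) (s : ℤ) (x : ℤ → 𝕜) : ℝ :=
  Real.sqrt (∑' n, ‖x n‖ ^ 2 * ν n ^ (2 * s))

end

noncomputable section

/-- The free Schrödinger flow `φ(t,x)_n = e^{-i t n²} x_n`. -/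
def flow (t : ℝ) (x : ℤ → ℂ) : ℤ → ℂ :=
  fun n => Complex.exp (-(t * (n : ℝ) ^ 2 : ℝ) * Complex.I) * x n

/-- The time-derivative of the free Schrödinger flow: `(−i n² e^{-itn²} x_n)_n`. -/
def dflow (t : ℝ) (x : ℤ → ℂ) : ℤ → ℂ :=
  fun n => -Complex.I * (n : ℂ) ^ 2 * Complex.exp (-(t * (n : ℝ) ^ 2 : ℝ) * Complex.I) * x n

end

noncomputable section

/-- The exponential on the imaginary axis has a quadratic Taylor remainder. -/
lemma norm_exp_ofReal_mul_I_sub_one_sub_le_sq (x : ℝ) :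
    ‖Complex.exp (x * Complex.I) - 1 - x * Complex.I‖ ≤ 2 * x ^ 2 := by
  have hz : ‖(x : ℂ) * Complex.I‖ = |x| := by simp
  rcases le_total |x| 1 with h | h
  · have := Complex.norm_exp_sub_one_sub_id_le (hz.trans_le h)
    rw [hz, sq_abs] at this
    nlinarith [sq_nonneg x]
  · have h1 := Real.norm_exp_I_mul_ofReal_sub_one_le (x := x)
    rw [mul_comm, Real.norm_eq_abs] at h1
    have h2 := norm_sub_le (Complex.exp (x * Complex.I) - 1) (x * Complex.I)
    nlinarith [sq_abs x]

/-- The exponential on the imaginary axis has a linearly bounded first-order Taylor remainder. -/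
lemma norm_exp_ofReal_mul_I_sub_one_sub_le (x : ℝ) :
    ‖Complex.exp (x * Complex.I) - 1 - x * Complex.I‖ ≤ 2 * |x| := by
  have hz : ‖(x : ℂ) * Complex.I‖ = |x| := by simp
  have h1 := Real.norm_exp_I_mul_ofReal_sub_one_le (x := x)
  rw [mul_comm, Real.norm_eq_abs] at h1
  have h2 := norm_sub_le (Complex.exp (x * Complex.I) - 1) (x * Complex.I)
  linarith

/-- Pointwise form of the Taylor remainder of the flow. -/
lemma flow_remainder_eq (t h : ℝ) (u ξ : ℤ → ℂ) (n : ℤ) :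
    flow (t + h) (fun m => u m + ξ m) n - flow t u n - flow t ξ n - (h : ℂ) * dflow t u n =
      Complex.exp ((-(t * (n : ℝ) ^ 2) : ℝ) * Complex.I) *
        ((Complex.exp ((-(h * (n : ℝ) ^ 2) : ℝ) * Complex.I) - 1
            - (-(h * (n : ℝ) ^ 2) : ℝ) * Complex.I) * u n
          + (Complex.exp ((-(h * (n : ℝ) ^ 2) : ℝ) * Complex.I) - 1) * ξ n) := by
  have hexp : Complex.exp (-((t + h) * (n : ℝ) ^ 2 : ℝ) * Complex.I) =
      Complex.exp ((-(t * (n : ℝ) ^ 2) : ℝ) * Complex.I) *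
        Complex.exp ((-(h * (n : ℝ) ^ 2) : ℝ) * Complex.I) := by
    rw [← Complex.exp_add]
    congr 1
    push_cast
    ring
  simp only [flow, dflow, hexp]
  push_cast
  ring

lemma norm_flow_remainder_sq_le (t h : ℝ) (u ξ : ℤ → ℂ) (n : ℤ) :
    ‖flow (t + h) (fun m => u m + ξ m) n - flow t u n - flow t ξ n
        - (h : ℂ) * dflow t u n‖ ^ 2 ≤
      2 * (‖Complex.exp ((-(h * (n : ℝ) ^ 2) : ℝ) * Complex.I) - 1
            - (-(h * (n : ℝ) ^ 2) : ℝ) * Complex.I‖ ^ 2 * ‖u n‖ ^ 2)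
        + 2 * (h ^ 2 * (‖ξ n‖ ^ 2 * (1 + (n : ℝ) ^ 2) ^ 2)) := by
  rw [flow_remainder_eq, norm_mul, Complex.norm_exp_ofReal_mul_I, one_mul]
  set x : ℝ := -(h * (n : ℝ) ^ 2) with hx
  set a := Complex.exp (x * Complex.I) - 1 - x * Complex.I
  have h1 : ‖Complex.exp (x * Complex.I) - 1‖ ≤ |x| := by
    have := Real.norm_exp_I_mul_ofReal_sub_one_le (x := x)
    rwa [mul_comm, Real.norm_eq_abs] at this
  have h2 : ‖Complex.exp (x * Complex.I) - 1‖ ^ 2 ≤ h ^ 2 * (1 + (n : ℝ) ^ 2) ^ 2 := by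
    calc _ ≤ |x| ^ 2 := by gcongr
      _ = h ^ 2 * ((n : ℝ) ^ 2) ^ 2 := by rw [sq_abs, hx]; ring
      _ ≤ _ := by gcongr; linarith
  calc _ ≤ (‖a * u n‖ + ‖(Complex.exp (x * Complex.I) - 1) * ξ n‖) ^ 2 := by
        gcongr
        exact norm_add_le _ _
    _ ≤ 2 * (‖a * u n‖ ^ 2 + ‖(Complex.exp (x * Complex.I) - 1) * ξ n‖ ^ 2) := add_sq_le
    _ = 2 * (‖a‖ ^ 2 * ‖u n‖ ^ 2)
        + 2 * (‖Complex.exp (x * Complex.I) - 1‖ ^ 2 * ‖ξ n‖ ^ 2) := by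
        rw [norm_mul, norm_mul]; ring
    _ ≤ 2 * (‖a‖ ^ 2 * ‖u n‖ ^ 2)
        + 2 * (h ^ 2 * (1 + (n : ℝ) ^ 2) ^ 2 * ‖ξ n‖ ^ 2) := by gcongr
    _ = _ := by ring

/-- Low frequencies obey the quadratic Taylor bound, high frequencies the linear one. -/
lemma norm_taylor_remainder_sq_mul_le (h : ℝ) (u : ℤ → ℂ) (S : Finset ℤ) (n : ℤ) :
    ‖Complex.exp ((-(h * (n : ℝ) ^ 2) : ℝ) * Complex.I) - 1
          - (-(h * (n : ℝ) ^ 2) : ℝ) * Complex.I‖ ^ 2 * ‖u n‖ ^ 2 ≤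
      4 * h ^ 4 * (if n ∈ S then (n : ℝ) ^ 8 * ‖u n‖ ^ 2 else 0)
        + 4 * h ^ 2 * (‖u n‖ ^ 2 * (1 + (n : ℝ) ^ 2) ^ 2
          - if n ∈ S then ‖u n‖ ^ 2 * (1 + (n : ℝ) ^ 2) ^ 2 else 0) := by
  have h1 := norm_exp_ofReal_mul_I_sub_one_sub_le_sq (-(h * (n : ℝ) ^ 2))
  have h2 := norm_exp_ofReal_mul_I_sub_one_sub_le (-(h * (n : ℝ) ^ 2))
  split_ifs with hn
  · calc _ ≤ (2 * (-(h * (n : ℝ) ^ 2)) ^ 2) ^ 2 * ‖u n‖ ^ 2 := by gcongr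
      _ = _ := by ring
  · calc _ ≤ (2 * |-(h * (n : ℝ) ^ 2)|) ^ 2 * ‖u n‖ ^ 2 := by gcongr
      _ = 4 * h ^ 2 * (‖u n‖ ^ 2 * ((n : ℝ) ^ 2) ^ 2) := by rw [mul_pow, sq_abs]; ring
      _ ≤ 4 * h ^ 2 * (‖u n‖ ^ 2 * (1 + (n : ℝ) ^ 2) ^ 2) := by gcongr; linarith
      _ = _ := by ring

/-- The free Schrödinger flow satisfies the sc¹ Fréchet condition at the
zeroth level: for every `t ∈ ℝ` and `u ∈ l^{2,2}` (Levi-Sobolev weight `ν_n = (1+n²)^{1/2}`),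
`‖φ(t+h, u+ξ) − φ(t,u) − φ(t,ξ) − h·(−i n² e^{-itn²} u_n)_n‖_0 / (|h| + ‖ξ‖_2) → 0`
as `(h,ξ) → (0,0)` with `h ∈ ℝ`, `ξ ∈ l^{2,2}` and `|h| + ‖ξ‖_2 > 0`. -/
theorem schrodinger_flow_sc1_frechet_condition (ν : ℤ → ℝ)
    (hν : ∀ n : ℤ, ν n = Real.sqrt (1 + (n : ℝ) ^ 2)) (t : ℝ)
    (u : ℤ → ℂ) (hu : WMem ν 2 u) :
    ∀ ε > (0 : ℝ), ∃ δ > (0 : ℝ), ∀ (h : ℝ) (ξ : ℤ → ℂ), WMem ν 2 ξ →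
      0 < |h| + wnorm ν 2 ξ → |h| + wnorm ν 2 ξ < δ →
      wnorm ν 0 (fun n => flow (t + h) (fun m => u m + ξ m) n - flow t u n - flow t ξ n
          - (h : ℂ) * dflow t u n) / (|h| + wnorm ν 2 ξ) < ε := by
  have hw : ∀ n, ν n ^ (2 * 2 : ℤ) = (1 + (n : ℝ) ^ 2) ^ 2 := fun n => by
    rw [hν, zpow_mul, zpow_ofNat, zpow_ofNat, Real.sq_sqrt (by positivity)]
  simp only [WMem, hw] at hu
  intro ε hε
  obtain ⟨S, hS⟩ := (hu.hasSum.eventually (lt_mem_nhds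
    (sub_lt_self (∑' n, ‖u n‖ ^ 2 * (1 + (n : ℝ) ^ 2) ^ 2)
      (by positivity : 0 < ε ^ 2 / 32)))).exists
  have hasSum_restrict (f : ℤ → ℝ) :
      HasSum (fun n => if n ∈ S then f n else 0) (∑ n ∈ S, f n) := by
    have := hasSum_sum_of_ne_finset_zero (f := fun n => if n ∈ S then f n else 0) (s := S)
      (L := .unconditional ℤ)
      (fun n hn => if_neg hn)
    rwa [Finset.sum_congr rfl (fun n hn => if_pos hn)] at this
  set C : ℝ := ∑ n ∈ S, (n : ℝ) ^ 8 * ‖u n‖ ^ 2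
  have hC : 0 ≤ C := Finset.sum_nonneg fun n _ => by positivity
  have hlow := hasSum_restrict fun n => (n : ℝ) ^ 8 * ‖u n‖ ^ 2
  have hhigh := hu.hasSum.sub
    (hasSum_restrict fun n => ‖u n‖ ^ 2 * (1 + (n : ℝ) ^ 2) ^ 2)
  refine ⟨Real.sqrt (ε ^ 2 / (2 * (2 + 8 * C))), by positivity, fun h ξ hξ hpos hlt => ?_⟩
  rw [div_lt_iff₀ hpos]
  simp only [WMem, hw] at hξ
  have hr := (Real.lt_sqrt hpos.le).1 hlt
  have hξ_sq : ∑' n, ‖ξ n‖ ^ 2 * (1 + (n : ℝ) ^ 2) ^ 2 = wnorm ν 2 ξ ^ 2 := by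
    simp only [wnorm, hw]
    exact (Real.sq_sqrt (tsum_nonneg fun n => by positivity)).symm
  have hbound := (((hlow.mul_left (4 * h ^ 4)).add (hhigh.mul_left (4 * h ^ 2))).mul_left 2).add
    ((hξ.hasSum.mul_left (h ^ 2)).mul_left 2)
  have hle (n : ℤ) := (norm_flow_remainder_sq_le t h u ξ n).trans
    (add_le_add_left (mul_le_mul_of_nonneg_left
      (norm_taylor_remainder_sq_mul_le h u S n) zero_le_two) _)
  have hsum := (Summable.of_nonneg_of_le (fun n => sq_nonneg _) hle
    hbound.summable).hasSum
  have htotal := hasSum_le hle hsum hbound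
  rw [hξ_sq] at htotal
  have hN : 0 ≤ wnorm ν 2 ξ := Real.sqrt_nonneg _
  set N := wnorm ν 2 ξ
  set r := |h| + N
  have hhr : h ^ 2 ≤ r ^ 2 :=
    sq_le_sq' (by linarith [neg_abs_le h]) (by linarith [le_abs_self h])
  have hNr : N ^ 2 ≤ r ^ 2 := by
    have : N ≤ r := le_add_of_nonneg_left (abs_nonneg h)
    gcongr
  have hr' : (2 + 8 * C) * r ^ 2 < ε ^ 2 / 2 := by
    rw [lt_div_iff₀ (by positivity)] at hr
    linarith
  simp only [wnorm, mul_zero, zpow_zero, mul_one]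
  rw [Real.sqrt_lt' (by positivity)]
  refine htotal.trans_lt ?_
  calc _ ≤ 2 * (4 * (h ^ 2) ^ 2 * C + 4 * h ^ 2 * (ε ^ 2 / 32)) + 2 * (h ^ 2 * N ^ 2) := by
        rw [← pow_mul]
        gcongr
        linarith
    _ ≤ 2 * (4 * (r ^ 2) ^ 2 * C + 4 * r ^ 2 * (ε ^ 2 / 32)) + 2 * (r ^ 2 * r ^ 2) := by gcongr
    _ = r ^ 2 * ((2 + 8 * C) * r ^ 2 + ε ^ 2 / 4) := by ring
    _ < r ^ 2 * ε ^ 2 := by gcongr; linarith [pow_pos hε 2]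
    _ = (ε * r) ^ 2 := by ring

end
end

section
/- The free Schrödinger group is norm-continuous through the compact embedding l^{2,2} ↪ l^{2,0}: the map ℝ → B(l^{2,2}, l^{2,0}) sending t to the operator x ↦ φ(t,x) (viewing an element of l^{2,2} inside l^{2,0}) is continuous with respect to the operator norm on B(l^{2,2}, l^{2,0}); that is, for every t ∈ ℝ, sup{‖φ(t+h,x) − φ(t,x)‖_0 : x ∈ l^{2,2}, ‖x‖_2 ≤ 1} → 0 as h → 0. -/
open Filter Topology

noncomputable section

/-- The phases of the free flow are Lipschitz in time, mode by mode. -/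
theorem norm_flow_sub_flow_le (t h : ℝ) (x : ℤ → ℂ) (n : ℤ) :
    ‖flow (t + h) x n - flow t x n‖ ≤ |h| * (n : ℝ) ^ 2 * ‖x n‖ := by
  have factor : flow (t + h) x n - flow t x n =
      Complex.exp ((-(t * (n : ℝ) ^ 2) : ℝ) * Complex.I) *
        (Complex.exp (Complex.I * (-(h * (n : ℝ) ^ 2) : ℝ)) - 1) * x n := by
    unfold flow
    rw [mul_sub, ← Complex.exp_add, mul_one, sub_mul]
    congr 3 <;> congr 1 <;> push_cast <;> ring
  rw [factor, norm_mul, norm_mul, Complex.norm_exp_ofReal_mul_I, one_mul]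
  gcongr
  refine Real.norm_exp_I_mul_ofReal_sub_one_le.trans_eq ?_
  rw [Real.norm_eq_abs, abs_neg, abs_mul, abs_of_nonneg (sq_nonneg (n : ℝ))]

/-- The free flow is Lipschitz in time from `l^{2,2}` to `l^{2,0}`. -/
theorem wnorm_flow_sub_flow_le {ν : ℤ → ℝ}
    (hν : ∀ n : ℤ, ν n = Real.sqrt (1 + (n : ℝ) ^ 2)) (t h : ℝ) {x : ℤ → ℂ}
    (hx : WMem ν 2 x) :
    wnorm ν 0 (fun n => flow (t + h) x n - flow t x n) ≤ |h| * wnorm ν 2 x := by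
  have weight (n : ℤ) : ν n ^ (2 * 2 : ℤ) = (1 + (n : ℝ) ^ 2) ^ 2 := by
    have hsq : ν n ^ 2 = 1 + (n : ℝ) ^ 2 := by rw [hν, Real.sq_sqrt (by positivity)]
    rw [← hsq, ← pow_mul]
    norm_cast
  have mode_le (n : ℤ) : ‖flow (t + h) x n - flow t x n‖ ^ 2 * ν n ^ (2 * 0 : ℤ) ≤
      |h| ^ 2 * (‖x n‖ ^ 2 * ν n ^ (2 * 2 : ℤ)) := by
    rw [weight, mul_zero, zpow_zero, mul_one]
    calc ‖flow (t + h) x n - flow t x n‖ ^ 2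
        ≤ (|h| * (1 + (n : ℝ) ^ 2) * ‖x n‖) ^ 2 := by
          gcongr
          refine (norm_flow_sub_flow_le t h x n).trans ?_
          gcongr
          linarith
      _ = |h| ^ 2 * (‖x n‖ ^ 2 * (1 + (n : ℝ) ^ 2) ^ 2) := by ring
  have summable_bound := Summable.mul_left (|h| ^ 2) hx
  have summable_diff := Summable.of_nonneg_of_le
    (fun n => by rw [mul_zero, zpow_zero, mul_one]; positivity) mode_le summable_bound
  unfold wnorm
  calc _ ≤ Real.sqrt (∑' n, |h| ^ 2 * (‖x n‖ ^ 2 * ν n ^ (2 * 2 : ℤ))) :=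
        Real.sqrt_le_sqrt (summable_diff.tsum_le_tsum mode_le summable_bound)
    _ = _ := by
        rw [tsum_mul_left, Real.sqrt_mul (sq_nonneg _), Real.sqrt_sq (abs_nonneg h)]

/-- The free Schrödinger group is operator-norm continuous through the
compact embedding `l^{2,2} ↪ l^{2,0}` (Levi-Sobolev weight): for every `t ∈ ℝ`,
`sup {‖φ(t+h,x) − φ(t,x)‖_0 : ‖x‖_2 ≤ 1} → 0` as `h → 0`. -/
theorem schrodinger_flow_opnorm_continuous (ν : ℤ → ℝ)
    (hν : ∀ n : ℤ, ν n = Real.sqrt (1 + (n : ℝ) ^ 2)) (t : ℝ) :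
    ∀ ε > (0 : ℝ), ∃ δ > (0 : ℝ), ∀ h : ℝ, |h| < δ →
      ∀ x : ℤ → ℂ, WMem ν 2 x → wnorm ν 2 x ≤ 1 →
        wnorm ν 0 (fun n => flow (t + h) x n - flow t x n) < ε := by
  intro ε hε
  refine ⟨ε, hε, fun h hh x hx hx1 => ?_⟩
  calc wnorm ν 0 (fun n => flow (t + h) x n - flow t x n)
      ≤ |h| * wnorm ν 2 x := wnorm_flow_sub_flow_le hν t h hx
    _ ≤ |h| := mul_le_of_le_one_right (abs_nonneg h) hx1
    _ < ε := hh

end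
end
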